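/- arXiv:2301.00132 — 3 statements merged into one kernel-verified Lean document; each statement's English description precedes it below -/
import Mathlib

section
/- Let η be any ball configuration. Then for every x ∈ ℕ and k ∈ ℕ: (i) if η↑_k(x) = 1 then ∑_{y=1}^{x} (η↑_ℓ(y) − η↓_ℓ(y)) = 1 for every 1 ≤ ℓ ≤ k; (ii) if η↓_k(x) = 1 then ∑_{y=1}^{x} (η↑_ℓ(y) − η↓_ℓ(y)) = 0 for every 1 ≤ ℓ ≤ k; (iii) if r(x) = 1 then ∑_{y=1}^{x} (η↑_k(y) − η↓_k(y)) = 0 for every k ∈ ℕ. -/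
open Finset

namespace BBS

attribute [local instance] Classical.propDecidable

noncomputable section

/-- A ball configuration: `η x ∈ {0,1}`; the sites are `x = 1, 2, ...` and
the index `0` is never used. -/
def IsConf (η : ℕ → ℤ) : Prop := ∀ x, η x = 0 ∨ η x = 1

/-- The carrier with seat numbers: `W η x k = 𝒲_k(x)` (seats `k = 1, 2, ...`). -/
def W (η : ℕ → ℤ) : ℕ → ℕ → ℤ
  | 0 => fun _ => 0
  | x + 1 => fun k =>
      W η x k
        + η (x + 1) * (1 - W η x k) * ∏ ℓ ∈ Finset.Icc 1 (k - 1), W η x ℓ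
        - (1 - η (x + 1)) * W η x k * ∏ ℓ ∈ Finset.Icc 1 (k - 1), (1 - W η x ℓ)

/-- The seat number configuration `η↑_k(x)`. -/
def up (η : ℕ → ℤ) (k x : ℕ) : ℤ :=
  η x * (1 - W η (x - 1) k) * ∏ ℓ ∈ Finset.Icc 1 (k - 1), W η (x - 1) ℓ

/-- The seat number configuration `η↓_k(x)`. -/
def down (η : ℕ → ℤ) (k x : ℕ) : ℤ :=
  (1 - η x) * W η (x - 1) k * ∏ ℓ ∈ Finset.Icc 1 (k - 1), (1 - W η (x - 1) ℓ)

/-- The record indicator `r(x) = 1 - ∑_{k ∈ ℕ} (η↑_k(x) + η↓_k(x))`. -/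
def rcd (η : ℕ → ℤ) (x : ℕ) : ℤ :=
  1 - ∑' k : ℕ, if 1 ≤ k then up η k x + down η k x else 0

/-- `m^σ_k(x) = ∑_{y=1}^x (η^σ_k(y) - η^σ_{k+1}(y))`, generic in the seat family `e`. -/
def mSeq (e : ℕ → ℕ → ℤ) (k x : ℕ) : ℤ :=
  ∑ y ∈ Finset.Icc 1 x, (e k y - e (k + 1) y)

/-- `m↑_k(x)` -/
def mUp (η : ℕ → ℤ) : ℕ → ℕ → ℤ := mSeq (up η)

/-- `m↓_k(x)` -/
def mDown (η : ℕ → ℤ) : ℕ → ℕ → ℤ := mSeq (down η)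

/-- `ξ_k(x) = x - ∑_{ℓ=1}^k ∑_{y=1}^x (η↑_ℓ(y) + η↓_ℓ(y))`. -/
def xi (η : ℕ → ℤ) (k x : ℕ) : ℤ :=
  (x : ℤ) - ∑ ℓ ∈ Finset.Icc 1 k, ∑ y ∈ Finset.Icc 1 x, (up η ℓ y + down η ℓ y)

/-- `{x : m↑_k(x) ≥ j ∧ m↓_k(x) ≥ j}`; `τ_k(j) < ∞` iff this set is nonempty. -/
def tauSet (η : ℕ → ℤ) (k j : ℕ) : Set ℕ :=
  {x : ℕ | (j : ℤ) ≤ mUp η k x ∧ (j : ℤ) ≤ mDown η k x}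

/-- `τ_k(j)` (with junk value `0` when `τ_k(j) = ∞`). -/
def tau (η : ℕ → ℤ) (k j : ℕ) : ℕ := sInf (tauSet η k j)

/-- `ζ_k(i)`, the number of `j` with `τ_k(j) < ∞` at effective position `ξ_k(τ_k(j)) = i`. -/
def zeta (η : ℕ → ℤ) (k : ℕ) (i : ℤ) : ℕ :=
  Set.ncard {j : ℕ | 1 ≤ j ∧ (tauSet η k j).Nonempty ∧ xi η k (tau η k j) = i}

/-- `{x : ξ_k(x) = i}`; `s_k(i) < ∞` iff this set is nonempty. -/
def sSet (η : ℕ → ℤ) (k : ℕ) (i : ℤ) : Set ℕ := {x : ℕ | xi η k x = i}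

/-- `s_k(i)` (with junk value `0` when `s_k(i) = ∞`). -/
def sPos (η : ℕ → ℤ) (k : ℕ) (i : ℤ) : ℕ := sInf (sSet η k i)

/-- The carrier with infinite capacity: `carrier η x = W_∞(x)`. -/
def carrier (η : ℕ → ℤ) : ℕ → ℤ
  | 0 => 0
  | x + 1 => carrier η x + η (x + 1) - min (1 - η (x + 1)) (carrier η x)

/-- The BBS time evolution `T`. -/
def Tev (η : ℕ → ℤ) (x : ℕ) : ℤ := η x + carrier η (x - 1) - carrier η x

/-- The carrier with capacity `c ∈ ℕ ∪ {∞}`. -/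
def carrierC (c : ℕ∞) (η : ℕ → ℤ) : ℕ → ℤ
  | 0 => 0
  | x + 1 =>
      carrierC c η x
        + (if c = ⊤ then η (x + 1)
            else min (η (x + 1)) (((c.toNat : ℕ) : ℤ) - carrierC c η x))
        - min (1 - η (x + 1)) (carrierC c η x)

/-- The BBS time evolution `T_ℓ` with carrier capacity `ℓ = c`. -/
def TevC (c : ℕ∞) (η : ℕ → ℤ) (x : ℕ) : ℤ :=
  η x + carrierC c η (x - 1) - carrierC c η x

/-- `p^σ_k(x) = x - 2 ∑_{ℓ=1}^k ∑_{y=1}^x η^σ_ℓ(y)`, generic in the seat family `e`. -/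
def pSeat (e : ℕ → ℕ → ℤ) (k x : ℕ) : ℤ :=
  (x : ℤ) - 2 * ∑ ℓ ∈ Finset.Icc 1 k, ∑ y ∈ Finset.Icc 1 x, e ℓ y

/-- `t^σ_k(x,j) = max{1 ≤ y ≤ x : m^σ_k(y) = j, η^σ_k(y) = 1}`. -/
def tmax (e : ℕ → ℕ → ℤ) (k x : ℕ) (j : ℤ) : ℕ :=
  sSup {y : ℕ | 1 ≤ y ∧ y ≤ x ∧ mSeq e k y = j ∧ e k y = 1}

/-- The largest entry of a multiset of integers (junk for the empty multiset). -/
def maxE (s : Multiset ℤ) : ℤ := sSup {a : ℤ | a ∈ s}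

/-- The refined rigging algorithm: `rigSeq e x k` is the multiset of entries of the
array `J^σ_k(x)`, where `e = η^σ`. -/
def rigSeq (e : ℕ → ℕ → ℤ) : ℕ → ℕ → Multiset ℤ
  | 0 => fun _ => 0
  | x + 1 =>
      let J := rigSeq e x
      let k1 := sSup {k : ℕ | 1 ≤ k ∧ e k (x + 1) = 1}
      if k1 = 0 then J
      else fun j =>
        if j = k1 then pSeat e k1 (x + 1) ::ₘ J j
        else if 1 ≤ j ∧ j + 1 = k1 then (J j).erase (maxE (J j))
        else J j

/-- The KKR algorithm: `kkr η x k` is the multiset of rigging entries attached to the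
rows of length `k` of the rigged partition `(μ(x), J(x))`. -/
def kkr (η : ℕ → ℤ) : ℕ → ℕ → Multiset ℤ
  | 0 => fun _ => 0
  | x + 1 =>
      let R := kkr η x
      if η (x + 1) = 1 then
        -- the vacancy `p_k(x)` of the current rigged partition
        let p : ℕ → ℤ := fun k =>
          (x : ℤ) - 2 * ∑' j : ℕ, ((R j).card : ℤ) * min (j : ℤ) (k : ℤ)
        -- the maximal length of a singular row (`0` if there is none)
        let k0 : ℕ := sSup {k : ℕ | 1 ≤ k ∧ p k ∈ R k ∧ ∀ a ∈ R k, a ≤ p k}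
        -- the multiplicities of the new partition `μ(x+1)`
        let m' : ℕ → ℤ := fun j =>
          ((R j).card : ℤ) + (if j = k0 + 1 then 1 else 0) - (if 1 ≤ j ∧ j = k0 then 1 else 0)
        -- the vacancy `p_{k0+1}(x+1)` of the new rigged partition
        let p' : ℤ := ((x : ℤ) + 1) - 2 * ∑' j : ℕ, m' j * min (j : ℤ) ((k0 : ℤ) + 1)
        fun k =>
          if k = k0 + 1 then p' ::ₘ R k
          else if k = k0 then (R k).erase (p k0)
          else R k
      else R

/-- The conjugate partition `λ_k(x)` of `μ(x)` in the KKR algorithm. -/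
def lamKKR (η : ℕ → ℤ) (k x : ℕ) : ℤ :=
  ∑' j : ℕ, if k ≤ j then ((kkr η x j).card : ℤ) else 0

/-- The vacancy `p_k(x) = x - 2 ∑_i min{μ_i(x), k}` in the KKR algorithm. -/
def pKKR (η : ℕ → ℤ) (k x : ℕ) : ℤ :=
  (x : ℤ) - 2 * ∑' j : ℕ, ((kkr η x j).card : ℤ) * min (j : ℤ) (k : ℤ)

/-! Interlacing Young diagrams.  A Young diagram is encoded as the multiset of its
(positive) row lengths. -/

/-- The conjugate partition: `conj μ k = λ_k`, the number of rows of length `≥ k`. -/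
def conj (μ : Multiset ℕ) (k : ℕ) : ℕ := (μ.filter (fun r => k ≤ r)).card

/-- `(μ↑, μ↓)` is interlacing: `μ↑_1 ≥ μ↓_1 ≥ μ↑_2 ≥ μ↓_2 ≥ ⋯`, equivalently
`λ↑_k − λ↓_k ∈ {0,1}` for all `k ≥ 1`. -/
def Interlacing (a b : Multiset ℕ) : Prop :=
  ∀ k, 1 ≤ k → conj b k ≤ conj a k ∧ conj a k ≤ conj b k + 1

/-- `{k ≥ 1 : λ↑_ℓ − λ↓_ℓ = 1 for all 1 ≤ ℓ ≤ k}`. -/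
def kUpSet (a b : Multiset ℕ) : Set ℕ :=
  {k : ℕ | 1 ≤ k ∧ ∀ ℓ, 1 ≤ ℓ → ℓ ≤ k → conj a ℓ = conj b ℓ + 1}

/-- `{k ≥ 1 : λ↑_ℓ − λ↓_ℓ = 0 for all 1 ≤ ℓ ≤ k}`. -/
def kDownSet (a b : Multiset ℕ) : Set ℕ :=
  {k : ℕ | 1 ≤ k ∧ ∀ ℓ, 1 ≤ ℓ → ℓ ≤ k → conj a ℓ = conj b ℓ}

/-- `k↑` (with `sup ∅ = 0`). -/
def kUp (a b : Multiset ℕ) : ℕ := sSup (kUpSet a b)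

/-- `k↓` (with `sup ∅ = 0`; junk value `0` also when `k↓ = ∞`, i.e. `μ↑ = μ↓`). -/
def kDown (a b : Multiset ℕ) : ℕ := sSup (kDownSet a b)

/-- Add one box to a row of length `k` (a new row of length `1` is added if `k = 0`). -/
def addBox (μ : Multiset ℕ) (k : ℕ) : Multiset ℕ := (k + 1) ::ₘ μ.erase k

/-- The interlacing-diagrams algorithm producing `(μ↑(x), μ↓(x))`. -/
def ydPair (η : ℕ → ℤ) : ℕ → Multiset ℕ × Multiset ℕ
  | 0 => (0, 0)
  | x + 1 =>
      let P := ydPair η x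
      if η (x + 1) = 1 then (addBox P.1 (kUp P.1 P.2), P.2)
      else if P.1 ≠ P.2 then (P.1, addBox P.2 (kDown P.1 P.2))
      else P

/-! The Takahashi–Satsuma algorithm and the slot configuration.  The state of the
algorithm is the set `C` of crossed-out sites. -/

/-- The sites not yet crossed out. -/
def active (C : Set ℕ) : Set ℕ := {x | 1 ≤ x ∧ x ∉ C}

/-- The maximal run (of consecutive equal letters among uncrossed sites) containing `x`. -/
def runOf (η : ℕ → ℤ) (C : Set ℕ) (x : ℕ) : Set ℕ :=
  {y | x ∈ active C ∧ y ∈ active C ∧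
    ∀ z ∈ active C, min x y ≤ z → z ≤ max x y → η z = η x}

/-- The length of the run containing `x`, in `ℕ∞`. -/
def runLen (η : ℕ → ℤ) (C : Set ℕ) (x : ℕ) : ℕ∞ :=
  if (runOf η C x).Infinite then ⊤ else ((runOf η C x).ncard : ℕ∞)

/-- The first sites of runs qualifying for the TS step: the run has a preceding run and
is at least as long as it. -/
def qualSet (η : ℕ → ℤ) (C : Set ℕ) : Set ℕ :=
  {b | b ∈ active C ∧ sInf (runOf η C b) = b ∧
    {y ∈ active C | y < b}.Nonempty ∧
    runLen η C (sSup {y ∈ active C | y < b}) ≤ runLen η C b}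

/-- The first site of the leftmost qualifying run. -/
def bSel (η : ℕ → ℤ) (C : Set ℕ) : ℕ := sInf (qualSet η C)

/-- The last site of the run preceding the selected run. -/
def prevSel (η : ℕ → ℤ) (C : Set ℕ) : ℕ :=
  sSup {y ∈ active C | y < bSel η C}

/-- The last `k` letters of the preceding run (the whole preceding run, whose length is `k`). -/
def S1 (η : ℕ → ℤ) (C : Set ℕ) : Set ℕ := runOf η C (prevSel η C)

/-- The first `k` letters of the selected run. -/
def S2 (η : ℕ → ℤ) (C : Set ℕ) : Set ℕ :=
  {y ∈ runOf η C (bSel η C) |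
    ({z ∈ runOf η C (bSel η C) | z ≤ y}).ncard ≤ (S1 η C).ncard}

/-- One step of the TS algorithm: cross out the identified soliton (if any run qualifies). -/
def tsStep (η : ℕ → ℤ) (C : Set ℕ) : Set ℕ :=
  if (qualSet η C).Nonempty then C ∪ S1 η C ∪ S2 η C else C

/-- The crossed-out sites after `n` steps of the TS algorithm. -/
def tsC (η : ℕ → ℤ) : ℕ → Set ℕ
  | 0 => ∅
  | n + 1 => tsStep η (tsC η n)

/-- The slot configuration `ν : ℕ → ℤ_{≥0} ∪ {∞}`: for a `k`-soliton
`γ = {z_1 < ⋯ < z_{2k}}`, `ν(z_l) = ν(z_{l+k}) = l − 1`, and `ν(x) = ∞` for records. -/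
def nuTS (η : ℕ → ℤ) (z : ℕ) : ℕ∞ :=
  if _h : ∃ n, z ∈ tsC η (n + 1) ∧ z ∉ tsC η n then
    let n := sInf {n : ℕ | z ∈ tsC η (n + 1) ∧ z ∉ tsC η n}
    if z ∈ S1 η (tsC η n) then (({w ∈ S1 η (tsC η n) | w < z}).ncard : ℕ∞)
    else (({w ∈ S2 η (tsC η n) | w < z}).ncard : ℕ∞)
  else ⊤

/-- `ξ̃_k(x)`, the number of `k`-slots in `[1,x]`. -/
def xiTS (η : ℕ → ℤ) (k x : ℕ) : ℕ :=
  Set.ncard {y : ℕ | 1 ≤ y ∧ y ≤ x ∧ (k : ℕ∞) ≤ nuTS η y}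

/-- `s̃_k(i)`, the position of the `i`-th `k`-slot. -/
def sTS (η : ℕ → ℤ) (k i : ℕ) : ℕ := sInf {x : ℕ | xiTS η k x = i}

/-- The slot decomposition `ζ̃_k(i)`: the number of `k`-solitons appended to the
`i`-th `k`-slot. -/
def zetaTS (η : ℕ → ℤ) (k i : ℕ) : ℕ :=
  Set.ncard {n : ℕ | (qualSet η (tsC η n)).Nonempty ∧ (S1 η (tsC η n)).ncard = k ∧
    ∀ z ∈ S1 η (tsC η n) ∪ S2 η (tsC η n), sTS η k i ≤ z ∧ z ≤ sTS η k (i + 1) - 1}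

end

end BBS

namespace BBS

theorem prod_eq_zero_or_one {s : Finset ℕ} {f : ℕ → ℤ} (h : ∀ i, f i = 0 ∨ f i = 1) :
    ∏ i ∈ s, f i = 0 ∨ ∏ i ∈ s, f i = 1 := by
  by_cases h0 : ∃ i ∈ s, f i = 0
  · obtain ⟨i, hi, hi0⟩ := h0
    exact Or.inl (Finset.prod_eq_zero hi hi0)
  · push Not at h0
    exact Or.inr (Finset.prod_eq_one fun i hi => (h i).resolve_left (h0 i hi))

theorem W_succ (η : ℕ → ℤ) (x k : ℕ) :
    W η (x + 1) k = W η x k + up η k (x + 1) - down η k (x + 1) := rfl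

theorem sum_up_sub_down (η : ℕ → ℤ) (x k : ℕ) :
    ∑ y ∈ Finset.Icc 1 x, (up η k y - down η k y) = W η x k := by
  induction x with
  | zero => rfl
  | succ x ih => rw [Finset.sum_Icc_succ_top (by omega), ih, W_succ]; ring

theorem W_eq_zero_or_one {η : ℕ → ℤ} (hη : IsConf η) (x k : ℕ) :
    W η x k = 0 ∨ W η x k = 1 := by
  induction x generalizing k with
  | zero => exact Or.inl rfl
  | succ x ih =>
    have hP := prod_eq_zero_or_one (s := Finset.Icc 1 (k - 1)) ih
    have hQ := prod_eq_zero_or_one (s := Finset.Icc 1 (k - 1)) (f := fun ℓ => 1 - W η x ℓ)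
      fun ℓ => by rcases ih ℓ with h | h <;> simp [h]
    simp only [W_succ, up, down, Nat.add_sub_cancel]
    rcases hη (x + 1) with he | he <;> rcases ih k with hw | hw <;>
      rcases hP with hP | hP <;> rcases hQ with hQ | hQ <;> simp [he, hw, hP, hQ]

theorem W_eq_zero_of_lt (η : ℕ → ℤ) {x k : ℕ} (h : x < k) : W η x k = 0 := by
  induction x generalizing k with
  | zero => rfl
  | succ x ih =>
    have hP : ∏ ℓ ∈ Finset.Icc 1 (k - 1), W η x ℓ = 0 :=
      Finset.prod_eq_zero (i := x + 1) (Finset.mem_Icc.2 ⟨by omega, by omega⟩) (ih (by omega))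
    simp [W_succ, up, down, hP, ih (show x < k by omega)]

theorem up_nonneg {η : ℕ → ℤ} (hη : IsConf η) (k x : ℕ) : 0 ≤ up η k x := by
  have hW := W_eq_zero_or_one hη (x - 1)
  refine mul_nonneg (mul_nonneg ?_ ?_) (Finset.prod_nonneg fun ℓ _ => ?_)
  · rcases hη x with h | h <;> simp [h]
  · rcases hW k with h | h <;> simp [h]
  · rcases hW ℓ with h | h <;> simp [h]

theorem down_nonneg {η : ℕ → ℤ} (hη : IsConf η) (k x : ℕ) : 0 ≤ down η k x := by
  have hW := W_eq_zero_or_one hη (x - 1)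
  refine mul_nonneg (mul_nonneg ?_ ?_) (Finset.prod_nonneg fun ℓ _ => ?_)
  · rcases hη x with h | h <;> simp [h]
  · rcases hW k with h | h <;> simp [h]
  · rcases hW ℓ with h | h <;> simp [h]

theorem W_eq_one_of_up_eq_one {η : ℕ → ℤ} (hη : IsConf η) {k x : ℕ}
    (h : up η k (x + 1) = 1) {ℓ : ℕ} (h1 : 1 ≤ ℓ) (hℓ : ℓ ≤ k) : W η (x + 1) ℓ = 1 := by
  have hne : up η k (x + 1) ≠ 0 := by simp [h]
  simp only [up, Nat.add_sub_cancel, mul_ne_zero_iff, Finset.prod_ne_zero_iff,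
    Finset.mem_Icc] at hne
  obtain ⟨⟨he, hk⟩, hP⟩ := hne
  have he : η (x + 1) = 1 := (hη _).resolve_left he
  have hk : W η x k = 0 := (W_eq_zero_or_one hη x k).resolve_right fun h => hk (by simp [h])
  have hd : down η ℓ (x + 1) = 0 := by simp [down, he]
  rcases hℓ.eq_or_lt with rfl | hlt
  · rw [W_succ, hk, h, hd]; rfl
  · have hw : W η x ℓ = 1 := (W_eq_zero_or_one hη x ℓ).resolve_left (hP ℓ ⟨h1, by omega⟩)
    have hu : up η ℓ (x + 1) = 0 := by simp [up, hw]
    rw [W_succ, hw, hu, hd]; rfl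

theorem W_eq_zero_of_down_eq_one {η : ℕ → ℤ} (hη : IsConf η) {k x : ℕ}
    (h : down η k (x + 1) = 1) {ℓ : ℕ} (h1 : 1 ≤ ℓ) (hℓ : ℓ ≤ k) : W η (x + 1) ℓ = 0 := by
  have hne : down η k (x + 1) ≠ 0 := by simp [h]
  simp only [down, Nat.add_sub_cancel, mul_ne_zero_iff, Finset.prod_ne_zero_iff,
    Finset.mem_Icc] at hne
  obtain ⟨⟨he, hk⟩, hP⟩ := hne
  have he : η (x + 1) = 0 := (hη _).resolve_right fun h => he (by simp [h])
  have hk : W η x k = 1 := (W_eq_zero_or_one hη x k).resolve_left hk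
  have hu : up η ℓ (x + 1) = 0 := by simp [up, he]
  rcases hℓ.eq_or_lt with rfl | hlt
  · rw [W_succ, hk, h, hu]; rfl
  · have hw : W η x ℓ = 0 := (W_eq_zero_or_one hη x ℓ).resolve_right fun hw =>
      hP ℓ ⟨h1, by omega⟩ (by simp [hw])
    have hd : down η ℓ (x + 1) = 0 := by simp [down, hw]
    rw [W_succ, hw, hu, hd]; rfl

theorem up_eq_zero_and_down_eq_zero_of_rcd_eq_one {η : ℕ → ℤ} (hη : IsConf η) {x : ℕ}
    (h : rcd η (x + 1) = 1) {k : ℕ} (hk : 1 ≤ k) :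
    up η k (x + 1) = 0 ∧ down η k (x + 1) = 0 := by
  have hfin : ∀ j ∉ Finset.range (x + 2),
      (if 1 ≤ j then up η j (x + 1) + down η j (x + 1) else 0) = 0 := by
    intro j hj
    have hj : x + 2 ≤ j := by simpa using hj
    have hP : ∏ ℓ ∈ Finset.Icc 1 (j - 1), W η x ℓ = 0 :=
      Finset.prod_eq_zero (i := x + 1) (Finset.mem_Icc.2 ⟨by omega, by omega⟩)
        (W_eq_zero_of_lt η (by omega))
    simp [up, down, hP, W_eq_zero_of_lt η (show x < j by omega)]
  have hnonneg : ∀ j, 0 ≤ if 1 ≤ j then up η j (x + 1) + down η j (x + 1) else 0 := by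
    intro j
    split_ifs
    · exact add_nonneg (up_nonneg hη _ _) (down_nonneg hη _ _)
    · exact le_rfl
  have hsum : ∑ j ∈ Finset.range (x + 2),
      (if 1 ≤ j then up η j (x + 1) + down η j (x + 1) else 0) = 0 := by
    rw [rcd, tsum_eq_sum hfin] at h
    linarith
  have hall := (Finset.sum_eq_zero_iff_of_nonneg fun j _ => hnonneg j).1 hsum
  have hkz : (if 1 ≤ k then up η k (x + 1) + down η k (x + 1) else 0) = 0 := by
    by_cases hm : k ∈ Finset.range (x + 2)
    · exact hall k hm
    · exact hfin k hm
  rw [if_pos hk] at hkz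
  have hu := up_nonneg hη k (x + 1)
  have hd := down_nonneg hη k (x + 1)
  constructor <;> linarith

theorem W_eq_zero_of_rcd_eq_one {η : ℕ → ℤ} (hη : IsConf η) {x : ℕ}
    (h : rcd η (x + 1) = 1) {k : ℕ} (hk : 1 ≤ k) : W η (x + 1) k = 0 := by
  have hud := fun j (hj : 1 ≤ j) => up_eq_zero_and_down_eq_zero_of_rcd_eq_one hη h hj
  have hW := W_eq_zero_or_one hη x
  rw [W_succ, (hud k hk).1, (hud k hk).2]
  rcases hη (x + 1) with he | he
  · suffices ∀ j, 1 ≤ j → W η x j = 0 by simp [this k hk]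
    intro j
    induction j using Nat.strong_induction_on with
    | _ j ih =>
      intro hj
      have hQ : ∏ ℓ ∈ Finset.Icc 1 (j - 1), (1 - W η x ℓ) = 1 :=
        Finset.prod_eq_one fun ℓ hℓ => by
          rw [Finset.mem_Icc] at hℓ
          simp [ih ℓ (by omega) hℓ.1]
      simpa [down, he, hQ] using (hud j hj).2
  · have hone : ∀ j, 1 ≤ j → W η x j = 1 := by
      intro j
      induction j using Nat.strong_induction_on with
      | _ j ih =>
        intro hj
        have hP : ∏ ℓ ∈ Finset.Icc 1 (j - 1), W η x ℓ = 1 :=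
          Finset.prod_eq_one fun ℓ hℓ => by
            rw [Finset.mem_Icc] at hℓ
            exact ih ℓ (by omega) hℓ.1
        have hu := (hud j hj).1
        simp only [up, Nat.add_sub_cancel, he, hP] at hu
        linarith
    have := hone (x + 1) (by omega)
    simp [W_eq_zero_of_lt η (Nat.lt_succ_self x)] at this

/-- Lemma 3.1: basic properties of the seat number configuration. -/
theorem statement0 (η : ℕ → ℤ) (hη : IsConf η) (x : ℕ) (hx : 1 ≤ x) (k : ℕ) (hk : 1 ≤ k) :
    (up η k x = 1 → ∀ ℓ, 1 ≤ ℓ → ℓ ≤ k →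
        ∑ y ∈ Finset.Icc 1 x, (up η ℓ y - down η ℓ y) = 1) ∧
    (down η k x = 1 → ∀ ℓ, 1 ≤ ℓ → ℓ ≤ k →
        ∑ y ∈ Finset.Icc 1 x, (up η ℓ y - down η ℓ y) = 0) ∧
    (rcd η x = 1 → ∑ y ∈ Finset.Icc 1 x, (up η k y - down η k y) = 0) := by
  obtain ⟨x, rfl⟩ := Nat.exists_eq_add_of_le' hx
  simp only [sum_up_sub_down]
  exact ⟨fun h _ h1 hℓ => W_eq_one_of_up_eq_one hη h h1 hℓ,
    fun h _ h1 hℓ => W_eq_zero_of_down_eq_one hη h h1 hℓ,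
    fun h => W_eq_zero_of_rcd_eq_one hη h hk⟩

end BBS
end

section
/- Let η be any ball configuration. If η↑_k(x) = 1 for some x ∈ ℕ and k ∈ ℕ, then ∑_{ℓ ≥ k} (Tη)↓_ℓ(x) + (Tr)(x) = 1, where (Tη)↓_ℓ and Tr are the seat number configuration and record indicator of the time-evolved configuration Tη. -/
open Finset

namespace BBS

attribute [local instance] Classical.propDecidable

end BBS

namespace BBS

open scoped Classical in
lemma prod_eq_ite_of_zero_or_one {f : ℕ → ℤ} (hf : ∀ i, f i = 0 ∨ f i = 1) (s : Finset ℕ) :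
    ∏ i ∈ s, f i = if ∀ i ∈ s, f i = 1 then 1 else 0 := by
  split_ifs with h
  · exact Finset.prod_eq_one h
  · push Not at h
    obtain ⟨i, hi, hne⟩ := h
    exact Finset.prod_eq_zero hi ((hf i).resolve_right hne)

lemma W_zero_or_one {η : ℕ → ℤ} (hη : IsConf η) (x : ℕ) :
    ∀ k, W η x k = 0 ∨ W η x k = 1 := by
  induction x with
  | zero => intro k; simp [W]
  | succ x ih =>
    intro k
    have h₁ := prod_eq_ite_of_zero_or_one ih (Finset.Icc 1 (k - 1))
    have h₀ := prod_eq_ite_of_zero_or_one (f := fun ℓ => 1 - W η x ℓ)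
      (fun ℓ => by have := ih ℓ; lia) (Finset.Icc 1 (k - 1))
    simp only [W, h₁, h₀]
    rcases hη (x + 1) with h | h <;> rcases ih k with h' | h' <;> rw [h, h'] <;>
      split_ifs <;> simp

open scoped Classical in
/-- A ball entering the carrier takes the first empty seat. -/
lemma W_succ_of_one {η : ℕ → ℤ} (hη : IsConf η) {x : ℕ} (h : η (x + 1) = 1) (k : ℕ) :
    W η (x + 1) k =
      if ∀ ℓ ∈ Finset.Icc 1 (k - 1), W η x ℓ = 1 then 1 else W η x k := by
  simp only [W, h, prod_eq_ite_of_zero_or_one (W_zero_or_one hη x)]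
  split_ifs <;> ring

open scoped Classical in
/-- An empty site takes the ball from the first occupied seat. -/
lemma W_succ_of_zero {η : ℕ → ℤ} (hη : IsConf η) {x : ℕ} (h : η (x + 1) = 0) (k : ℕ) :
    W η (x + 1) k =
      if ∀ ℓ ∈ Finset.Icc 1 (k - 1), W η x ℓ = 0 then 0 else W η x k := by
  have h₀ := prod_eq_ite_of_zero_or_one (f := fun ℓ => 1 - W η x ℓ)
    (fun ℓ => by have := W_zero_or_one hη x ℓ; lia) (Finset.Icc 1 (k - 1))
  simp only [W, h, h₀, sub_eq_self]
  split_ifs <;> ring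

lemma sum_one_sub_mul_prod (f : ℕ → ℤ) (n : ℕ) :
    ∑ k ∈ Finset.Icc 1 n, (1 - f k) * ∏ ℓ ∈ Finset.Icc 1 (k - 1), f ℓ =
      1 - ∏ ℓ ∈ Finset.Icc 1 n, f ℓ := by
  induction n with
  | zero => simp
  | succ n ih =>
    rw [Finset.sum_Icc_succ_top (by lia), Finset.prod_Icc_succ_top (by lia), ih,
      Nat.add_sub_cancel]
    ring

lemma sum_W_succ (η : ℕ → ℤ) (x n : ℕ) :
    ∑ k ∈ Finset.Icc 1 n, W η (x + 1) k = ∑ k ∈ Finset.Icc 1 n, W η x k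
      + η (x + 1) * (1 - ∏ ℓ ∈ Finset.Icc 1 n, W η x ℓ)
      - (1 - η (x + 1)) * (1 - ∏ ℓ ∈ Finset.Icc 1 n, (1 - W η x ℓ)) := by
  rw [← sum_one_sub_mul_prod (W η x), ← sum_one_sub_mul_prod (fun ℓ => 1 - W η x ℓ)]
  simp only [W, Finset.sum_add_distrib, Finset.sum_sub_distrib, Finset.mul_sum, mul_assoc,
    sub_sub_cancel]

lemma carrier_nonneg {η : ℕ → ℤ} (hη : IsConf η) (x : ℕ) : 0 ≤ carrier η x := by
  induction x with
  | zero => simp [carrier]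
  | succ x ih =>
    simp only [carrier]
    rcases hη (x + 1) with h | h <;> rw [h] <;> lia

lemma sum_W_le_carrier {η : ℕ → ℤ} (hη : IsConf η) (x : ℕ) :
    ∀ n, ∑ k ∈ Finset.Icc 1 n, W η x k ≤ carrier η x := by
  induction x with
  | zero => intro n; simp [W, carrier]
  | succ x ih =>
    intro n
    have hle := ih n
    have hc := carrier_nonneg hη x
    have hW := W_zero_or_one hη x
    rw [sum_W_succ]
    simp only [carrier]
    rcases hη (x + 1) with h | h
    · have h₀ := prod_eq_ite_of_zero_or_one (f := fun ℓ => 1 - W η x ℓ)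
        (fun ℓ => by have := hW ℓ; lia) (Finset.Icc 1 n)
      rw [h, h₀]
      split_ifs with h'
      · have : ∑ k ∈ Finset.Icc 1 n, W η x k = 0 :=
          Finset.sum_eq_zero fun k hk => by have := h' k hk; lia
        lia
      · lia
    · have hp : 0 ≤ ∏ ℓ ∈ Finset.Icc 1 n, W η x ℓ :=
        Finset.prod_nonneg fun ℓ _ => by have := hW ℓ; lia
      rw [h]
      lia

lemma W_eq_zero_of_carrier_eq_zero {η : ℕ → ℤ} (hη : IsConf η) {x : ℕ}
    (h : carrier η x = 0) {k : ℕ} (hk : 1 ≤ k) : W η x k = 0 := by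
  have hW := W_zero_or_one hη x
  have hle := Finset.single_le_sum (f := W η x) (s := Finset.Icc 1 k)
    (fun ℓ _ => by have := hW ℓ; lia) (Finset.mem_Icc.2 ⟨hk, le_rfl⟩)
  have := sum_W_le_carrier hη x k
  have := hW k
  lia

lemma Tev_succ (η : ℕ → ℤ) (x : ℕ) :
    Tev η (x + 1) = min (1 - η (x + 1)) (carrier η x) := by
  simp only [Tev, carrier, Nat.add_sub_cancel]
  ring

lemma isConf_Tev {η : ℕ → ℤ} (hη : IsConf η) : IsConf (Tev η) := by
  rintro (_ | x)
  · simpa [Tev] using hη 0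
  · rw [Tev_succ]
    have := carrier_nonneg hη x
    rcases hη (x + 1) with h | h <;> rw [h] <;> lia

lemma Tev_succ_of_one {η : ℕ → ℤ} (hη : IsConf η) {x : ℕ} (h : η (x + 1) = 1) :
    Tev η (x + 1) = 0 := by
  have := carrier_nonneg hη x
  rw [Tev_succ, h]
  lia

/-- No seat is occupied in both carriers, and every seat before an occupied seat of the
first carrier is occupied in exactly one of the two carriers. -/
lemma W_add_W_Tev {η : ℕ → ℤ} (hη : IsConf η) (x : ℕ) :
    (∀ k, 1 ≤ k → W η x k + W (Tev η) x k ≤ 1) ∧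
    (∀ i j, 1 ≤ i → i < j → W η x j = 1 → W η x i + W (Tev η) x i = 1) := by
  induction x with
  | zero => simp [W]
  | succ x ih =>
    obtain ⟨hexcl, hpre⟩ := ih
    have hT := isConf_Tev hη
    have hU := W_zero_or_one hη x
    have hV := W_zero_or_one hT x
    rcases hη (x + 1) with h | h
    · rcases hT (x + 1) with hT' | hT'
      · have hc : carrier η x = 0 := by
          have := Tev_succ η x
          lia
        have hU' (k : ℕ) (hk : 1 ≤ k) : W η (x + 1) k = 0 := by
          rw [W_succ_of_zero hη h, W_eq_zero_of_carrier_eq_zero hη hc hk, ite_self]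
        refine ⟨fun k hk => ?_, fun i j hi hij hj => ?_⟩
        · have := hU' k hk
          have := W_zero_or_one hT (x + 1) k
          lia
        · have := hU' j (by lia)
          lia
      · refine ⟨fun k hk => ?_, fun i j hi hij => ?_⟩ <;>
          simp only [W_succ_of_zero hη h, W_succ_of_one hT hT', Finset.mem_Icc]
        · grind
        · grind
    · have hT' := Tev_succ_of_one hη h
      refine ⟨fun k hk => ?_, fun i j hi hij => ?_⟩ <;>
        simp only [W_succ_of_one hη h, W_succ_of_zero hT hT', Finset.mem_Icc]
      · grind
      · grind

/-- Proposition 3.2, second part: if `η↑_k(x) = 1` then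
`∑_{ℓ ≥ k} (Tη)↓_ℓ(x) + (Tr)(x) = 1`. -/
theorem statement2 (η : ℕ → ℤ) (hη : IsConf η) (x : ℕ) (hx : 1 ≤ x) (k : ℕ) (hk : 1 ≤ k)
    (h : up η k x = 1) :
    (∑' ℓ : ℕ, if k ≤ ℓ then down (Tev η) ℓ x else 0) + rcd (Tev η) x = 1 := by
  obtain ⟨x, rfl⟩ := Nat.exists_eq_add_of_le' hx
  simp only [up, Nat.add_sub_cancel] at h
  have hη1 : η (x + 1) = 1 := (hη _).resolve_left fun h0 => by simp [h0] at h
  have hT := Tev_succ_of_one hη hη1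
  have hW (ℓ : ℕ) (hℓ : 1 ≤ ℓ) (hℓk : ℓ < k) : W (Tev η) x ℓ = 0 := by
    have h1 : W η x ℓ = 1 := (W_zero_or_one hη x ℓ).resolve_left fun h0 => by
      rw [Finset.prod_eq_zero (Finset.mem_Icc.2 ⟨hℓ, by lia⟩) h0] at h
      simp at h
    have := (W_add_W_Tev hη x).1 ℓ hℓ
    have := W_zero_or_one (isConf_Tev hη) x ℓ
    lia
  have heq (ℓ : ℕ) : (if k ≤ ℓ then down (Tev η) ℓ (x + 1) else 0) =
      if 1 ≤ ℓ then up (Tev η) ℓ (x + 1) + down (Tev η) ℓ (x + 1) else 0 := by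
    have hup : up (Tev η) ℓ (x + 1) = 0 := by simp [up, hT]
    rw [hup, zero_add]
    split_ifs with h1 h2 h2
    · rfl
    · lia
    · simp [down, hW ℓ h2 (by lia)]
    · rfl
  simp only [rcd, heq]
  ring

end BBS
end

section
/- Let (μ↑, μ↓) be a pair of interlacing Young diagrams. For σ ∈ {↑,↓}, let μ̃^σ be the Young diagram obtained from μ^σ by adding one box to a row of length k^σ (i.e., replacing a row of length k^σ by a row of length k^σ + 1; if k^σ = 0, a new row of length 1 is added). Then (μ̃↑, μ↓) is a pair of interlacing Young diagrams; and, if μ↑ ≠ μ↓, then (μ↑, μ̃↓) is also a pair of interlacing Young diagrams. -/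
open Finset

namespace BBS

attribute [local instance] Classical.propDecidable

end BBS

namespace BBS

theorem conj_cons (r : ℕ) (μ : Multiset ℕ) (l : ℕ) :
    conj (r ::ₘ μ) l = conj μ l + if l ≤ r then 1 else 0 := by
  unfold conj
  by_cases h : l ≤ r <;> simp [h]

theorem conj_antitone (μ : Multiset ℕ) : Antitone (conj μ) := by
  intro k l hkl
  exact Multiset.card_le_card (Multiset.monotone_filter_right μ fun _ h => hkl.trans h)

/-- The multiplicity of `k` is the difference of consecutive columns. -/
theorem conj_eq_conj_succ_add_count (μ : Multiset ℕ) (k : ℕ) :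
    conj μ k = conj μ (k + 1) + μ.count k := by
  induction μ using Multiset.induction_on with
  | empty => simp [conj]
  | cons r μ ih =>
    rw [conj_cons, conj_cons, Multiset.count_cons, ih]
    split_ifs <;> omega

theorem exists_conj_eq_zero (μ : Multiset ℕ) : ∃ n, ∀ l, n ≤ l → conj μ l = 0 := by
  induction μ using Multiset.induction_on with
  | empty => exact ⟨0, by simp [conj]⟩
  | cons r μ ih =>
    obtain ⟨n, hn⟩ := ih
    refine ⟨max n (r + 1), fun l hl => ?_⟩
    rw [conj_cons, hn l (by omega), if_neg (by omega)]

theorem eq_of_conj_eq {a b : Multiset ℕ} (ha : 0 ∉ a) (hb : 0 ∉ b)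
    (h : ∀ l, 1 ≤ l → conj a l = conj b l) : a = b := by
  ext r
  rcases Nat.eq_zero_or_pos r with rfl | hr
  · rw [Multiset.count_eq_zero_of_notMem ha, Multiset.count_eq_zero_of_notMem hb]
  · have h₁ := conj_eq_conj_succ_add_count a r
    have h₂ := conj_eq_conj_succ_add_count b r
    have h₃ := h r hr
    have h₄ := h (r + 1) (by omega)
    omega

/-- Adding a box to a row of length `k` lengthens exactly the column `k + 1`. -/
theorem conj_addBox {μ : Multiset ℕ} {k : ℕ} (hk : 1 ≤ k → k ∈ μ) {l : ℕ} (hl : 1 ≤ l) :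
    conj (addBox μ k) l = conj μ l + if l = k + 1 then 1 else 0 := by
  unfold addBox
  by_cases hmem : k ∈ μ
  · have h : conj μ l = conj (μ.erase k) l + if l ≤ k then 1 else 0 := by
      rw [← conj_cons, Multiset.cons_erase hmem]
    rw [conj_cons, h]
    split_ifs <;> omega
  · have hk0 : k = 0 := by
      by_contra h
      exact hmem (hk (by omega))
    rw [conj_cons, Multiset.erase_of_notMem hmem]
    split_ifs <;> omega

/-- The supremum of the initial segments of `{1, 2, …}` on which `P` holds is the last
point before the first failure of `P`. -/
theorem sSup_initial_segment {P : ℕ → Prop} (h : ∃ l, 1 ≤ l ∧ ¬ P l) {k : ℕ}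
    (hk : k = sSup {k : ℕ | 1 ≤ k ∧ ∀ l, 1 ≤ l → l ≤ k → P l}) :
    (1 ≤ k → P k) ∧ ¬ P (k + 1) := by
  obtain ⟨n, hn, hPn⟩ := h
  set S := {k : ℕ | 1 ≤ k ∧ ∀ l, 1 ≤ l → l ≤ k → P l} with hS
  have hbdd : BddAbove S := ⟨n, fun m hm => by
    by_contra hlt
    exact hPn (hm.2 n hn (by omega))⟩
  have hseg : ∀ l, 1 ≤ l → l ≤ k → P l := by
    intro l hl hlk
    have hne : S.Nonempty := by
      by_contra he
      rw [Set.not_nonempty_iff_eq_empty.mp he, csSup_empty] at hk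
      simp only [bot_eq_zero] at hk
      omega
    have hmem : k ∈ S := hk ▸ Nat.sSup_mem hne hbdd
    exact hmem.2 l hl hlk
  refine ⟨fun h1 => hseg k h1 le_rfl, fun hP => ?_⟩
  have hmem : k + 1 ∈ S := by
    refine ⟨by omega, fun l hl hlk => ?_⟩
    rcases Nat.lt_or_ge k l with hlt | hle
    · rwa [show l = k + 1 by omega]
    · exact hseg l hl hle
  have := le_csSup hbdd hmem
  omega

/-- Lemma 4.3: adding a box to a row of length `k^σ` preserves the interlacing
property. -/
theorem statement14 (a b : Multiset ℕ) (ha : 0 ∉ a) (hb : 0 ∉ b) (hab : Interlacing a b) :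
    Interlacing (addBox a (kUp a b)) b ∧
    (a ≠ b → Interlacing a (addBox b (kDown a b))) := by
  constructor
  · obtain ⟨n, hn⟩ := exists_conj_eq_zero a
    obtain ⟨hk, hk'⟩ := sSup_initial_segment (P := fun l => conj a l = conj b l + 1)
      ⟨n + 1, by omega, by simp [hn (n + 1) (by omega)]⟩ (show kUp a b = _ from rfl)
    generalize kUp a b = k at hk hk' ⊢
    have hnext := hab (k + 1) (by omega)
    have hmem : 1 ≤ k → k ∈ a := fun h => by
      rw [← Multiset.count_pos]
      have h₁ := conj_eq_conj_succ_add_count a k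
      have h₂ := conj_antitone b (Nat.le_succ k)
      have h₃ := hk h
      simp only [Nat.succ_eq_add_one] at h₂
      omega
    intro l hl
    rw [conj_addBox hmem hl]
    have h := hab l hl
    split_ifs with hlk
    · subst hlk
      omega
    · omega
  · intro hne
    have hex : ∃ l, 1 ≤ l ∧ ¬ conj a l = conj b l := by
      by_contra! h
      exact hne (eq_of_conj_eq ha hb h)
    obtain ⟨hk, hk'⟩ := sSup_initial_segment (P := fun l => conj a l = conj b l)
      hex (show kDown a b = _ from rfl)
    generalize kDown a b = k at hk hk' ⊢
    have hnext := hab (k + 1) (by omega)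
    have hmem : 1 ≤ k → k ∈ b := fun h => by
      rw [← Multiset.count_pos]
      have h₁ := conj_eq_conj_succ_add_count b k
      have h₂ := conj_antitone a (Nat.le_succ k)
      have h₃ := hk h
      simp only [Nat.succ_eq_add_one] at h₂
      omega
    intro l hl
    rw [conj_addBox hmem hl]
    have h := hab l hl
    split_ifs with hlk
    · subst hlk
      omega
    · omega

end BBS
end
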